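/- Let G = ⟨a,b_1,…,b_r⟩ be a multi-GGS-group with r ≥ 2. Then ψ(G″ ∩ st(1)) contains γ₃(G) × ⋯ × γ₃(G) (p factors). -/

import Mathlib

/-!
Automorphisms of the `p`-regular rooted tree, encoded by portraits:
an automorphism is a family of permutations of `Fin p`, one for each vertex
(vertices are finite words over `Fin p`, the root being `[]`).
-/

namespace TreeAut

variable {p : ℕ}

/-- Automorphisms of the `p`-regular rooted tree, given by their portraits. -/
def AutT (p : ℕ) : Type := List (Fin p) → Equiv.Perm (Fin p)

namespace AutT

/-- The action of a tree automorphism on the vertices (finite words over `Fin p`). -/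
def act : AutT p → List (Fin p) → List (Fin p)
  | _, [] => []
  | f, x :: w => f [] x :: act (fun v => f (x :: v)) w

/-- The section of `f` at the level-one vertex `x`; the map
`f ↦ (sections f 0, …, sections f (p-1))` restricted to the first-level
stabilizer is the isomorphism `ψ`. -/
def sections (f : AutT p) : Fin p → AutT p := fun x v => f (x :: v)

instance : One (AutT p) := ⟨fun _ => 1⟩

instance : Mul (AutT p) := ⟨fun f g v => f (act g v) * g v⟩

/-- The action of the inverse automorphism on vertices. -/
def invAct : AutT p → List (Fin p) → List (Fin p)
  | _, [] => []
  | f, x :: w => (f [])⁻¹ x :: invAct (fun v => f (((f [])⁻¹ x) :: v)) w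

instance : Inv (AutT p) := ⟨fun f v => (f (invAct f v))⁻¹⟩

lemma one_apply (v : List (Fin p)) : (1 : AutT p) v = 1 := rfl

lemma mul_apply (f g : AutT p) (v : List (Fin p)) : (f * g) v = f (act g v) * g v := rfl

lemma inv_apply (f : AutT p) (v : List (Fin p)) : f⁻¹ v = (f (invAct f v))⁻¹ := rfl

lemma act_nil (f : AutT p) : act f [] = [] := rfl

lemma act_cons (f : AutT p) (x : Fin p) (w : List (Fin p)) :
    act f (x :: w) = f [] x :: act (sections f x) w := rfl

lemma sections_mul (f g : AutT p) (x : Fin p) :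
    sections (f * g) x = sections f (g [] x) * sections g x :=
  funext fun _ => rfl

lemma act_one : ∀ v : List (Fin p), act (1 : AutT p) v = v
  | [] => rfl
  | x :: w => congrArg (x :: ·) (act_one w)

lemma act_mul (f g : AutT p) : ∀ v : List (Fin p), act (f * g) v = act f (act g v)
  | [] => rfl
  | x :: w => by
      rw [act_cons (f * g), sections_mul, act_mul, act_cons g, act_cons f]
      rfl

lemma invAct_act (f : AutT p) : ∀ v : List (Fin p), invAct f (act f v) = v
  | [] => rfl
  | x :: w => by
      rw [act_cons]
      show (f [])⁻¹ (f [] x) ::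
          invAct (fun v => f (((f [])⁻¹ (f [] x)) :: v)) (act (sections f x) w) = x :: w
      have h : (f [])⁻¹ (f [] x) = x := Equiv.symm_apply_apply (f []) x
      rw [h]
      exact congrArg (x :: ·) (invAct_act (sections f x) w)

instance : Group (AutT p) where
  mul_assoc f g h := by
    funext v
    show (f * g) (act h v) * h v = f (act (g * h) v) * (g * h) v
    rw [mul_apply, mul_apply, act_mul, mul_assoc]
  one_mul f := by
    funext v
    show (1 : AutT p) (act f v) * f v = f v
    rw [one_apply, one_mul]
  mul_one f := by
    funext v
    show f (act (1 : AutT p) v) * (1 : AutT p) v = f v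
    rw [act_one, one_apply, mul_one]
  inv_mul_cancel f := by
    funext v
    show f⁻¹ (act f v) * f v = (1 : AutT p) v
    rw [inv_apply, invAct_act, one_apply, inv_mul_cancel]

lemma act_length (f : AutT p) : ∀ v : List (Fin p), (act f v).length = v.length
  | [] => rfl
  | _ :: w => congrArg Nat.succ (act_length _ w)

lemma act_act_inv (f : AutT p) (v : List (Fin p)) : act f (act f⁻¹ v) = v := by
  rw [← act_mul, mul_inv_cancel, act_one]

/-- The pointwise stabilizer `st(n)` of the `n`-th level of the tree. -/
def levelStab (p n : ℕ) : Subgroup (AutT p) where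
  carrier := {f | ∀ v : List (Fin p), v.length = n → act f v = v}
  one_mem' := fun v _ => act_one v
  mul_mem' := by
    intro f g hf hg v hv
    rw [act_mul, hg v hv, hf v hv]
  inv_mem' := by
    intro f hf v hv
    have h1 : act f (act f⁻¹ v) = v := act_act_inv f v
    have h2 : act f (act f⁻¹ v) = act f⁻¹ v := hf _ (by rw [act_length, hv])
    exact h2.symm.trans h1

instance levelStab_normal (p n : ℕ) : (levelStab p n).Normal := by
  constructor
  intro f hf g v hv
  show act (g * f * g⁻¹) v = v
  rw [act_mul, act_mul, hf _ (by rw [act_length, hv]), act_act_inv]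

/-- The tuple of sections at the level-two vertices.  Restricted to the
second-level stabilizer this is the map `ψ₂`. -/
def sections2 (f : AutT p) : Fin p → Fin p → AutT p := fun x y v => f (x :: y :: v)

/-- The rooted automorphism defined by a permutation `σ` of `Fin p`. -/
def rooted (σ : Equiv.Perm (Fin p)) : AutT p := fun v => if v = [] then σ else 1

/-- The rooted automorphism `a`, acting at the root by the cycle `(1 2 … p)`. -/
def rootedA (p : ℕ) : AutT p := rooted (finRotate p)

/-- Auxiliary portrait for the directed automorphism `b_e`. -/
def directedAux (e : Fin (p - 1) → ZMod p) : List (Fin p) → Equiv.Perm (Fin p)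
  | [] => 1
  | x :: w =>
      if h : (x : ℕ) < p - 1 then
        (if w = [] then finRotate p ^ ((e ⟨x, h⟩).val) else 1)
      else directedAux e w

/-- The directed automorphism `b_e` defined by the vector `e ∈ 𝔽_p^{p-1}`,
i.e. the unique automorphism with `ψ(b_e) = (a^{e_1}, …, a^{e_{p-1}}, b_e)`. -/
def directed (e : Fin (p - 1) → ZMod p) : AutT p := directedAux e

/-- The multi-GGS-group determined by the vectors `e 1, …, e r`. -/
def multiGGS (p : ℕ) {r : ℕ} (e : Fin r → Fin (p - 1) → ZMod p) : Subgroup (AutT p) :=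
  Subgroup.closure ({rootedA p} ∪ Set.range fun i => directed (e i))

/-- The GGS-group `𝒢` defined by the (nonzero) constant vector `(c, …, c)`. -/
def constGGS (p : ℕ) (c : ZMod p) : Subgroup (AutT p) :=
  Subgroup.closure {rootedA p, directed (fun _ => c)}

/-- `G` is the GGS-group `𝒢` defined by a constant vector. -/
def IsConstGGS {p : ℕ} (G : Subgroup (AutT p)) : Prop :=
  ∃ c : ZMod p, c ≠ 0 ∧ G = constGGS p c

/-- The stabilizer `st_G(n) = G ∩ st(n)`, viewed as a subgroup of `G`. -/
def stabIn {p : ℕ} (G : Subgroup (AutT p)) (n : ℕ) : Subgroup G :=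
  (levelStab p n).comap G.subtype

instance {p : ℕ} (G : Subgroup (AutT p)) (n : ℕ) : (stabIn G n).Normal :=
  Subgroup.Normal.comap (levelStab_normal p n) G.subtype

/-- The congruence subgroup property: every finite-index subgroup of `G`
contains a level stabilizer `st_G(n)`. -/
def HasCSP {p : ℕ} (G : Subgroup (AutT p)) : Prop :=
  ∀ H : Subgroup G, H.FiniteIndex → ∃ n : ℕ, stabIn G n ≤ H

/-- `G` is just infinite: it is infinite and all its nontrivial normal
subgroups have finite index. -/
def JustInfinite {p : ℕ} (G : Subgroup (AutT p)) : Prop :=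
  Infinite G ∧ ∀ N : Subgroup G, N.Normal → N ≠ ⊥ → N.FiniteIndex

end AutT

end TreeAut

open TreeAut AutT Subgroup

namespace TreeAut.AutT

open scoped commutatorElement

/-! ### Level-one decompositions -/

section Sections

variable {p : ℕ}

lemma ext_root_sections {f g : AutT p} (h0 : f [] = g [])
    (h : ∀ x, sections f x = sections g x) : f = g := by
  funext v
  cases v with
  | nil => exact h0
  | cons x w => exact congrFun (h x) w

lemma mul_root (f g : AutT p) : (f * g) [] = f [] * g [] := rfl

lemma inv_root (f : AutT p) : f⁻¹ [] = (f [])⁻¹ := rfl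

lemma sections_one (x : Fin p) : sections (1 : AutT p) x = 1 := rfl

lemma sections_inv (f : AutT p) (x : Fin p) :
    sections f⁻¹ x = (sections f ((f [])⁻¹ x))⁻¹ := by
  rw [eq_inv_iff_mul_eq_one, ← Equiv.Perm.one_apply x, ← mul_inv_cancel (f [])]
  have h := sections_mul f⁻¹ f ((f [])⁻¹ x)
  rw [inv_mul_cancel, sections_one] at h
  simpa using h.symm

/-- The group of tree automorphisms acting trivially on the first level. -/
def rootStab (p : ℕ) : Subgroup (AutT p) where
  carrier := {f | f [] = 1}
  one_mem' := rfl
  mul_mem' := by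
    intro f g hf hg
    simp only [Set.mem_ofPred_eq] at *
    rw [mul_root, hf, hg, mul_one]
  inv_mem' := by
    intro f hf
    simp only [Set.mem_ofPred_eq] at *
    rw [inv_root, hf, inv_one]

lemma mem_rootStab {f : AutT p} : f ∈ rootStab p ↔ f [] = 1 := Iff.rfl

lemma rootStab_le_levelStab : rootStab p ≤ levelStab p 1 := by
  intro f hf v hv
  obtain ⟨x, rfl⟩ := List.length_eq_one_iff.1 hv
  rw [act_cons, act_nil, mem_rootStab.1 hf, Equiv.Perm.one_apply]

lemma sections_mul_of_mem {f g : AutT p} (hg : g ∈ rootStab p) (x : Fin p) :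
    sections (f * g) x = sections f x * sections g x := by
  rw [sections_mul, mem_rootStab.1 hg, Equiv.Perm.one_apply]

lemma sections_inv_of_mem {f : AutT p} (hf : f ∈ rootStab p) (x : Fin p) :
    sections f⁻¹ x = (sections f x)⁻¹ := by
  rw [sections_inv, mem_rootStab.1 hf, inv_one, Equiv.Perm.one_apply]

/-- Taking the section at `x`, as a homomorphism on the first-level stabilizer. -/
def sectionHom (x : Fin p) : rootStab p →* AutT p where
  toFun f := sections f.1 x
  map_one' := rfl
  map_mul' _ g := sections_mul_of_mem g.2 x

lemma sections_commutator_of_mem {f g : AutT p} (hf : f ∈ rootStab p) (hg : g ∈ rootStab p)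
    (x : Fin p) : sections ⁅f, g⁆ x = ⁅sections f x, sections g x⁆ :=
  map_commutatorElement (sectionHom x) ⟨f, hf⟩ ⟨g, hg⟩

/-- The sections at `x` of the elements of `H` that fix the first level. -/
def sectionSubgroup (H : Subgroup (AutT p)) (x : Fin p) : Subgroup (AutT p) :=
  (H.subgroupOf (rootStab p)).map (sectionHom x)

lemma mem_sectionSubgroup {H : Subgroup (AutT p)} {x : Fin p} {g : AutT p} :
    g ∈ sectionSubgroup H x ↔ ∃ h ∈ H, h ∈ rootStab p ∧ sections h x = g := by
  constructor
  · rintro ⟨⟨h, hr⟩, hH, rfl⟩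
    exact ⟨h, hH, hr, rfl⟩
  · rintro ⟨h, hH, hr, rfl⟩
    exact ⟨⟨h, hr⟩, hH, rfl⟩

/-- The automorphism fixing the first level whose only nontrivial section is `g`, at `x`. -/
def graft (x : Fin p) (g : AutT p) : AutT p
  | [] => 1
  | y :: w => if y = x then g w else 1

lemma graft_mem_rootStab (x : Fin p) (g : AutT p) : graft x g ∈ rootStab p := rfl

lemma sections_graft_self (x : Fin p) (g : AutT p) : sections (graft x g) x = g :=
  funext fun _ => if_pos rfl

lemma sections_graft_of_ne {x y : Fin p} (h : y ≠ x) (g : AutT p) :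
    sections (graft x g) y = 1 :=
  funext fun _ => if_neg h

lemma eq_graft_of_sections {f g : AutT p} {x : Fin p} (hf : f ∈ rootStab p)
    (hx : sections f x = g) (hne : ∀ y, y ≠ x → sections f y = 1) : f = graft x g := by
  refine ext_root_sections hf fun y => ?_
  by_cases h : y = x
  · rw [h, hx, sections_graft_self]
  · rw [hne y h, sections_graft_of_ne h]

/-- Grafting at `x`, as a homomorphism. -/
def graftHom (x : Fin p) : AutT p →* AutT p where
  toFun := graft x
  map_one' := (eq_graft_of_sections (one_mem _) rfl fun _ _ => rfl).symm
  map_mul' f g := by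
    symm
    refine eq_graft_of_sections
      (mul_mem (graft_mem_rootStab x f) (graft_mem_rootStab x g)) ?_ fun y hy => ?_
    · rw [sections_mul_of_mem (graft_mem_rootStab x g), sections_graft_self, sections_graft_self]
    · rw [sections_mul_of_mem (graft_mem_rootStab x g), sections_graft_of_ne hy,
        sections_graft_of_ne hy, mul_one]

lemma graft_conj {h : AutT p} (hh : h ∈ rootStab p) (x : Fin p) (m : AutT p) :
    h * graft x m * h⁻¹ = graft x (sections h x * m * (sections h x)⁻¹) := by
  have hi := inv_mem hh
  have hg := graft_mem_rootStab x m
  refine eq_graft_of_sections (mul_mem (mul_mem hh hg) hi) ?_ fun y hy => ?_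
  · rw [sections_mul_of_mem hi, sections_mul_of_mem hg, sections_graft_self,
      sections_inv_of_mem hh]
  · rw [sections_mul_of_mem hi, sections_mul_of_mem hg, sections_graft_of_ne hy,
      sections_inv_of_mem hh, mul_one, mul_inv_cancel]

lemma graft_commutator {h : AutT p} (hh : h ∈ rootStab p) (x : Fin p) (m : AutT p) :
    ⁅graft x m, h⁆ = graft x ⁅m, sections h x⁆ := by
  have hg := graft_mem_rootStab x m
  refine eq_graft_of_sections
    (by rw [commutatorElement_def]
        exact mul_mem (mul_mem (mul_mem hg hh) (inv_mem hg)) (inv_mem hh)) ?_ fun y hy => ?_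
  · rw [sections_commutator_of_mem hg hh, sections_graft_self]
  · rw [sections_commutator_of_mem hg hh, sections_graft_of_ne hy, commutatorElement_one_left]

/-- A subgroup containing all grafts of the entries of a tuple `g` contains an element of the
first-level stabilizer whose tuple of sections is `g`. -/
lemma exists_sections_eq_of_graft_mem {H : Subgroup (AutT p)} {g : Fin p → AutT p}
    (hg : ∀ x, graft x (g x) ∈ H) : ∃ f ∈ H ⊓ levelStab p 1, sections f = g := by
  have key : ∀ s : Finset (Fin p), ∃ f ∈ H, f ∈ rootStab p ∧
      ∀ x, sections f x = if x ∈ s then g x else 1 := by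
    intro s
    induction s using Finset.induction_on with
    | empty => exact ⟨1, one_mem _, one_mem _, fun x => by simp [sections_one]⟩
    | insert y s hy ih =>
      obtain ⟨f, hf, hr, hs⟩ := ih
      refine ⟨f * graft y (g y), mul_mem hf (hg y), mul_mem hr (graft_mem_rootStab _ _),
        fun x => ?_⟩
      rw [sections_mul_of_mem (graft_mem_rootStab _ _), hs]
      by_cases h : x = y
      · subst h
        simp [hy, sections_graft_self]
      · simp [h, sections_graft_of_ne h]
  obtain ⟨f, hf, hr, hs⟩ := key Finset.univ
  exact ⟨f, ⟨hf, rootStab_le_levelStab hr⟩, funext fun x => by simpa using hs x⟩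

/-- Rooted automorphisms form a group isomorphic to the symmetric group. -/
def rootedHom (p : ℕ) : Equiv.Perm (Fin p) →* AutT p where
  toFun := rooted
  map_one' := funext fun v => by simp [rooted, one_apply]
  map_mul' σ τ := funext fun v => by
    cases v <;> simp [rooted, mul_apply, act]

lemma sections_rooted (σ : Equiv.Perm (Fin p)) (x : Fin p) : sections (rooted σ) x = 1 :=
  funext fun v => by simp [sections, rooted, one_apply]

lemma rooted_inv (σ : Equiv.Perm (Fin p)) : (rooted σ)⁻¹ = rooted σ⁻¹ :=
  (map_inv (rootedHom p) σ).symm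

lemma rooted_conj_mem_rootStab (σ : Equiv.Perm (Fin p)) {b : AutT p} (hb : b ∈ rootStab p) :
    rooted σ * b * (rooted σ)⁻¹ ∈ rootStab p := by
  rw [mem_rootStab, mul_root, mul_root, inv_root, mem_rootStab.1 hb, mul_one, mul_inv_cancel]

lemma sections_rooted_conj (σ : Equiv.Perm (Fin p)) (b : AutT p) (x : Fin p) :
    sections (rooted σ * b * (rooted σ)⁻¹) x = sections b (σ⁻¹ x) := by
  rw [rooted_inv, sections_mul, sections_mul, sections_rooted, sections_rooted, one_mul, mul_one]
  rfl

lemma rooted_conj_graft (σ : Equiv.Perm (Fin p)) (x : Fin p) (g : AutT p) :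
    rooted σ * graft x g * (rooted σ)⁻¹ = graft (σ x) g := by
  refine eq_graft_of_sections (rooted_conj_mem_rootStab σ (graft_mem_rootStab x g)) ?_
    fun y hy => ?_
  · rw [sections_rooted_conj, Equiv.Perm.inv_eq_iff_eq.2 rfl, sections_graft_self]
  · rw [sections_rooted_conj, sections_graft_of_ne]
    exact fun h => hy (Equiv.Perm.inv_eq_iff_eq.1 h)

end Sections

/-! ### Commuting modulo a subgroup -/

section CommutingModulo

variable {Γ : Type*} [Group Γ]

/-- The elements of `G` that commute with `z` modulo `M`, where `G` normalizes `M`. -/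
def centralizerMod (G M : Subgroup Γ) (hG : ∀ g ∈ G, ∀ m ∈ M, g * m * g⁻¹ ∈ M) (z : Γ) :
    Subgroup Γ where
  carrier := {x | x ∈ G ∧ ⁅x, z⁆ ∈ M}
  one_mem' := ⟨one_mem _, by simp [one_mem]⟩
  mul_mem' := by
    rintro x y ⟨hx, hxz⟩ ⟨hy, hyz⟩
    refine ⟨mul_mem hx hy, ?_⟩
    have h : ⁅x * y, z⁆ = x * ⁅y, z⁆ * x⁻¹ * ⁅x, z⁆ := by
      simp only [commutatorElement_def]; group
    rw [h]
    exact mul_mem (hG x hx _ hyz) hxz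
  inv_mem' := by
    rintro x ⟨hx, hxz⟩
    refine ⟨inv_mem hx, ?_⟩
    have h : ⁅x⁻¹, z⁆ = x⁻¹ * ⁅x, z⁆⁻¹ * x⁻¹⁻¹ := by
      simp only [commutatorElement_def]; group
    rw [h]
    exact hG _ (inv_mem hx) _ (inv_mem hxz)

lemma mem_centralizerMod_comm {G M : Subgroup Γ} {hG : ∀ g ∈ G, ∀ m ∈ M, g * m * g⁻¹ ∈ M}
    {x z : Γ} (hz : z ∈ G) (h : x ∈ centralizerMod G M hG z) : z ∈ centralizerMod G M hG x :=
  ⟨hz, by rw [← commutatorElement_inv]; exact inv_mem h.2⟩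

lemma commutator_closure_le {S : Set Γ} {M : Subgroup Γ}
    (hM : ∀ g ∈ closure S, ∀ m ∈ M, g * m * g⁻¹ ∈ M)
    (hS : ∀ s ∈ S, ∀ t ∈ S, ⁅s, t⁆ ∈ M) : ⁅closure S, closure S⁆ ≤ M := by
  have h1 : ∀ t ∈ S, closure S ≤ centralizerMod (closure S) M hM t := fun t ht =>
    (closure_le _).2 fun s hs => ⟨subset_closure hs, hS s hs t ht⟩
  have h2 : ∀ x ∈ closure S, closure S ≤ centralizerMod (closure S) M hM x := fun x hx =>
    (closure_le _).2 fun t ht => mem_centralizerMod_comm (subset_closure ht) (h1 t ht hx)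
  exact commutator_le.2 fun x hx y hy => (h2 y hy hx).2

lemma map_conj_commutator_eq {H : Subgroup Γ} {t : Γ}
    (ht : H.map (MulAut.conj t).toMonoidHom = H) :
    ⁅H, H⁆.map (MulAut.conj t).toMonoidHom = ⁅H, H⁆ := by
  rw [map_commutator, ht]

end CommutingModulo

/-! ### Linear algebra of the defining vectors -/

section LinearAlgebra

variable {F ι : Type*} [Field F]

/-- Suppose that, whenever the coordinate `σ u` does not vanish on `E`, all the vectors of `E` with
vanishing coordinate `u` lie in `C`.  If `E` contains two independent vectors, then `E ≤ C`. -/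
lemma le_of_forall_coordinate {σ : ι → ι} (hσ : Function.Involutive σ) {E C : Submodule F (ι → F)}
    (h : ∀ u, ∀ f ∈ E, f (σ u) ≠ 0 → ∀ e ∈ E, e u = 0 → e ∈ C)
    {x y : ι → F} (hx : x ∈ E) (hy : y ∈ E) (hxy : LinearIndependent F ![x, y]) : E ≤ C := by
  have key : ∀ u, ∀ f ∈ E, f (σ u) ≠ 0 → ∀ c ∈ E, c ∈ C → c u ≠ 0 → E ≤ C := by
    intro u f hf hfu c hcE hcC hcu v hv
    have h1 : v - (v u / c u) • c ∈ C :=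
      h u f hf hfu _ (sub_mem hv (E.smul_mem _ hcE)) (by simp [hcu])
    simpa using add_mem h1 (C.smul_mem (v u / c u) hcC)
  obtain ⟨c, hcE, hcC, hc0⟩ : ∃ c ∈ E, c ∈ C ∧ c ≠ 0 := by
    have hx0 : x ≠ 0 := hxy.ne_zero 0
    obtain ⟨w, hw⟩ := Function.ne_iff.1 hx0
    have hgood := h (σ w) x hx (by rw [hσ w]; exact hw)
    by_cases hxu : x (σ w) = 0
    · exact ⟨x, hx, hgood x hx hxu, hx0⟩
    · have hmem : y - (y (σ w) / x (σ w)) • x ∈ E := sub_mem hy (E.smul_mem _ hx)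
      refine ⟨_, hmem, hgood _ hmem (by simp [hxu]), fun h0 => ?_⟩
      have := (LinearIndependent.pair_iff.1 hxy) (-(y (σ w) / x (σ w))) 1
        (by rw [← h0]; module)
      exact one_ne_zero this.2
  obtain ⟨m, hm⟩ := Function.ne_iff.1 hc0
  by_cases hE : ∀ f ∈ E, f (σ m) = 0
  · exact fun v hv => h (σ m) c hcE (by rw [hσ m]; exact hm) v hv (hE v hv)
  · push Not at hE
    obtain ⟨f, hf, hfm⟩ := hE
    exact key m f hf hfm c hcE hcC hm

/-- One of two independent vectors is not constant. -/
lemma exists_ne_of_linearIndependent [Nonempty ι] {x y : ι → F}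
    (hxy : LinearIndependent F ![x, y]) :
    (∃ u v, x u ≠ x v) ∨ ∃ u v, y u ≠ y v := by
  by_contra! hcon
  obtain ⟨hx, hy⟩ := hcon
  obtain ⟨u⟩ := ‹Nonempty ι›
  have h := LinearIndependent.pair_iff.1 hxy (y u) (-x u)
    (funext fun v => by simp [hx v u, hy v u, mul_comm])
  refine hxy.ne_zero 0 (funext fun v => ?_)
  simpa [hx v u] using h.2

end LinearAlgebra

/-! ### Directed automorphisms and multi-GGS-groups -/

section Directed

variable {n : ℕ}

/-- The rooted automorphism `a ^ c` for an exponent `c` modulo `p`. -/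
def rootedPow (c : ZMod (n + 1)) : AutT (n + 1) := rootedA (n + 1) ^ c.val

lemma finRotate_pow_apply (k : ℕ) (x : Fin (n + 1)) :
    (finRotate (n + 1) ^ k) x = x + Fin.ofNat (n + 1) k := by
  induction k with
  | zero => simp
  | succ k ih =>
    rw [pow_succ', Equiv.Perm.mul_apply, ih, finRotate_apply, add_assoc]
    congr 1
    ext
    simp [Fin.val_add]

lemma finRotate_pow_last (x : Fin (n + 1)) :
    (finRotate (n + 1) ^ ((x : ℕ) + 1)) (Fin.last n) = x := by
  rw [finRotate_pow_apply]
  ext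
  rw [Fin.val_add, Fin.val_ofNat, Nat.add_mod_mod, Fin.val_last,
    show n + ((x : ℕ) + 1) = x + (n + 1) by ring, Nat.add_mod_right, Nat.mod_eq_of_lt x.2]

lemma rootedA_pow (k : ℕ) : rootedA (n + 1) ^ k = rooted (finRotate (n + 1) ^ k) :=
  (map_pow (rootedHom (n + 1)) (finRotate (n + 1)) k).symm

lemma rootedA_pow_card : rootedA (n + 1) ^ (n + 1) = 1 := by
  rw [rootedA_pow]
  have : finRotate (n + 1) ^ (n + 1) = 1 := Equiv.ext fun x => by
    rw [finRotate_pow_apply]; simp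
  rw [this]
  exact map_one (rootedHom (n + 1))

lemma rootedPow_add (c d : ZMod (n + 1)) : rootedPow (c + d) = rootedPow c * rootedPow d := by
  rw [rootedPow, rootedPow, rootedPow, ZMod.val_add, ← pow_add,
    ← pow_eq_pow_mod _ rootedA_pow_card]

lemma rootedPow_zero : rootedPow (0 : ZMod (n + 1)) = 1 := by simp [rootedPow]

lemma rootedPow_commute (c d : ZMod (n + 1)) : Commute (rootedPow c) (rootedPow d) :=
  Commute.pow_pow (Commute.refl _) _ _

lemma rootedPow_pow (c : ZMod (n + 1)) (k : ℕ) : rootedPow c ^ k = rootedPow ((k : ZMod (n + 1)) * c) := by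
  induction k with
  | zero => simp [rootedPow_zero]
  | succ k ih => rw [pow_succ, ih, ← rootedPow_add]; congr 1; push_cast; ring

lemma rootedA_mem_of_rootedPow_mem [Fact (n + 1).Prime] {H : Subgroup (AutT (n + 1))}
    {c : ZMod (n + 1)} (hc : c ≠ 0) (h : rootedPow c ∈ H) : rootedA (n + 1) ∈ H := by
  have h1 : rootedPow c ^ (c⁻¹).val = rootedA (n + 1) := by
    rw [rootedPow_pow, ZMod.natCast_zmod_val, inv_mul_cancel₀ hc, rootedPow, ZMod.val_one,
      pow_one]
  exact h1 ▸ pow_mem h _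

lemma directed_mem_rootStab (e : Fin (n + 1 - 1) → ZMod (n + 1)) : directed e ∈ rootStab (n + 1) :=
  rfl

lemma sections_directed_castSucc (e : Fin (n + 1 - 1) → ZMod (n + 1)) (u : Fin (n + 1 - 1)) :
    sections (directed e) (Fin.castSucc u) = rootedPow (e u) := by
  rw [rootedPow, rootedA_pow]
  funext v
  have hu : ((Fin.castSucc u : Fin (n + 1)) : ℕ) < n + 1 - 1 := u.2
  simp only [sections, directed, directedAux, rooted, dif_pos hu]
  rfl

lemma sections_directed_last (e : Fin (n + 1 - 1) → ZMod (n + 1)) :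
    sections (directed e) (Fin.last n) = directed e := by
  funext v
  simp [sections, directed, directedAux]

lemma directed_add (e f : Fin (n + 1 - 1) → ZMod (n + 1)) :
    directed (e + f) = directed e * directed f := by
  funext v
  induction v with
  | nil => exact (mul_one _).symm
  | cons x w ih =>
    change sections (directed (e + f)) x w = sections (directed e * directed f) x w
    rw [sections_mul_of_mem (directed_mem_rootStab f)]
    induction x using Fin.lastCases with
    | last => simpa only [sections_directed_last] using ih
    | cast u =>
      rw [sections_directed_castSucc, sections_directed_castSucc, sections_directed_castSucc,
        Pi.add_apply, rootedPow_add]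

/-- `e ↦ b_e` as a homomorphism. -/
def directedHom (n : ℕ) : (Fin (n + 1 - 1) → ZMod (n + 1)) →+ Additive (AutT (n + 1)) :=
  AddMonoidHom.mk' (fun e => Additive.ofMul (directed e)) directed_add

/-- The vectors `e` for which `b_e` lies in `H`, as a subspace. -/
def directedIn (H : Subgroup (AutT (n + 1))) :
    Submodule (ZMod (n + 1)) (Fin (n + 1 - 1) → ZMod (n + 1)) :=
  AddSubgroup.toZModSubmodule (n + 1) (H.toAddSubgroup.comap (directedHom n))

lemma directed_commute (e f : Fin (n + 1 - 1) → ZMod (n + 1)) :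
    Commute (directed e) (directed f) := by
  rw [Commute, SemiconjBy, ← directed_add, ← directed_add, add_comm e f]

/-- If the coordinate of `e` at `u` vanishes, the commutator of `b_e` with a suitable conjugate of
`b_f` has a single nontrivial section. -/
lemma commutator_directed_conj {e : Fin (n + 1 - 1) → ZMod (n + 1)} {u : Fin (n + 1 - 1)}
    (he : e u = 0) (f : Fin (n + 1 - 1) → ZMod (n + 1)) :
    ⁅directed e, rootedA (n + 1) ^ ((u : ℕ) + 1) * directed f *
      (rootedA (n + 1) ^ ((u : ℕ) + 1))⁻¹⁆ =
    graft (Fin.last n) ⁅directed e, rootedPow (f (Fin.rev u))⁆ := by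
  rw [rootedA_pow]
  set σ := finRotate (n + 1) ^ ((u : ℕ) + 1) with hσ
  have hrev : σ (Fin.castSucc (Fin.rev u)) = Fin.last n := by
    rw [hσ, finRotate_pow_apply]
    ext
    have h1 := u.2
    have h2 : n - ((u : ℕ) + 1) + ((u : ℕ) + 1) = n := by omega
    simp only [Fin.val_add, Fin.val_castSucc, Fin.val_rev, Fin.val_ofNat, Nat.add_mod_mod, h2,
      Fin.val_last, Nat.mod_succ]
  have hlast : σ (Fin.last n) = Fin.castSucc u := finRotate_pow_last (Fin.castSucc u)
  have he' := directed_mem_rootStab e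
  have hf' := rooted_conj_mem_rootStab σ (directed_mem_rootStab f)
  refine eq_graft_of_sections ?_ ?_ fun x hx => ?_
  · rw [commutatorElement_def]
    exact mul_mem (mul_mem (mul_mem he' hf') (inv_mem he')) (inv_mem hf')
  · rw [sections_commutator_of_mem he' hf', sections_rooted_conj, sections_directed_last,
      Equiv.Perm.inv_eq_iff_eq.2 hrev.symm, sections_directed_castSucc]
  · rw [sections_commutator_of_mem he' hf', sections_rooted_conj,
      commutatorElement_eq_one_iff_commute]
    obtain ⟨v, rfl⟩ := Fin.exists_castSucc_eq.2 hx
    rw [sections_directed_castSucc]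
    obtain hy | ⟨w, hw⟩ := (Fin.eq_castSucc_or_eq_last (σ⁻¹ (Fin.castSucc v))).symm
    · rw [Equiv.Perm.inv_eq_iff_eq, hlast] at hy
      obtain rfl : v = u := Fin.castSucc_injective _ hy
      rw [he, rootedPow_zero]
      exact Commute.one_left _
    · rw [hw, sections_directed_castSucc]
      exact rootedPow_commute _ _

end Directed

section MultiGGS

variable {n r : ℕ} {e : Fin r → Fin (n + 1 - 1) → ZMod (n + 1)}

lemma rootedA_mem_multiGGS : rootedA (n + 1) ∈ multiGGS (n + 1) e :=
  subset_closure (Or.inl rfl)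

lemma directed_mem_multiGGS (i : Fin r) : directed (e i) ∈ multiGGS (n + 1) e :=
  subset_closure (Or.inr ⟨i, rfl⟩)

/-- Sections at the last vertex of the commutators of powers of `a` with `b_i`. -/
lemma rootedPow_mul_directed_inv_mem (i : Fin r) (u : Fin (n + 1 - 1)) :
    rootedPow (e i u) * (directed (e i))⁻¹ ∈
      sectionSubgroup ⁅multiGGS (n + 1) e, multiGGS (n + 1) e⁆ (Fin.last n) := by
  have hb := directed_mem_rootStab (e i)
  obtain ⟨k, hk⟩ : ∃ k : ℕ, (finRotate (n + 1) ^ k) (Fin.castSucc u) = Fin.last n :=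
    ⟨n - u, by
      rw [finRotate_pow_apply]
      ext
      have h1 := u.2
      simp [Fin.val_add]⟩
  refine mem_sectionSubgroup.2 ⟨⁅rootedA (n + 1) ^ k, directed (e i)⁆,
    commutator_mem_commutator (pow_mem rootedA_mem_multiGGS k) (directed_mem_multiGGS i), ?_⟩
  rw [rootedA_pow, commutatorElement_def]
  refine ⟨mul_mem (rooted_conj_mem_rootStab _ hb) (inv_mem hb), ?_⟩
  rw [sections_mul_of_mem (inv_mem hb), sections_inv_of_mem hb, sections_directed_last,
    sections_rooted_conj, Equiv.Perm.inv_eq_iff_eq.2 hk.symm, sections_directed_castSucc]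

/-- The derived subgroup projects onto the whole group at the last vertex, unless all the defining
vectors are constant. -/
lemma multiGGS_le_sectionSubgroup [Fact (n + 1).Prime] {i : Fin r} {u v : Fin (n + 1 - 1)}
    (huv : e i u ≠ e i v) :
    multiGGS (n + 1) e ≤
      sectionSubgroup ⁅multiGGS (n + 1) e, multiGGS (n + 1) e⁆ (Fin.last n) := by
  have ha : rootedA (n + 1) ∈
      sectionSubgroup ⁅multiGGS (n + 1) e, multiGGS (n + 1) e⁆ (Fin.last n) := by
    refine rootedA_mem_of_rootedPow_mem (sub_ne_zero.2 huv) ?_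
    have h := mul_mem (rootedPow_mul_directed_inv_mem (e := e) i u)
      (inv_mem (rootedPow_mul_directed_inv_mem (e := e) i v))
    have h2 : rootedPow (e i u - e i v) = rootedPow (e i u) * (rootedPow (e i v))⁻¹ := by
      rw [eq_mul_inv_iff_mul_eq, ← rootedPow_add, sub_add_cancel]
    rw [h2]
    simpa [mul_assoc] using h
  refine (closure_le _).2 ?_
  rintro _ (rfl | ⟨j, rfl⟩)
  · exact ha
  · have h := mul_mem (inv_mem (rootedPow_mul_directed_inv_mem (e := e) j u))
      (pow_mem ha (e j u).val)
    simpa [rootedPow] using h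

/-- The derived subgroup is regular branching: it contains the grafts of its elements. -/
lemma commutator_le_comap_graftHom [Fact (n + 1).Prime] {i j : Fin r}
    (hij : LinearIndependent (ZMod (n + 1)) ![e i, e j])
    (hsec : multiGGS (n + 1) e ≤
      sectionSubgroup ⁅multiGGS (n + 1) e, multiGGS (n + 1) e⁆ (Fin.last n)) :
    ⁅multiGGS (n + 1) e, multiGGS (n + 1) e⁆ ≤
      ⁅multiGGS (n + 1) e, multiGGS (n + 1) e⁆.comap (graftHom (Fin.last n)) := by
  set G := multiGGS (n + 1) e with hG
  set M := ⁅G, G⁆.comap (graftHom (Fin.last n)) with hMdef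
  have hM : ∀ g ∈ G, ∀ m ∈ M, g * m * g⁻¹ ∈ M := by
    intro g hg m hm
    obtain ⟨h, hh, hr, rfl⟩ := mem_sectionSubgroup.1 (hsec hg)
    change graft _ _ ∈ ⁅G, G⁆
    rw [← graft_conj hr]
    exact mul_mem (mul_mem hh hm) (inv_mem hh)
  have hle : directedIn G ≤ directedIn (centralizerMod G M hM (rootedA (n + 1))) := by
    refine le_of_forall_coordinate Fin.rev_involutive ?_ (directed_mem_multiGGS i)
      (directed_mem_multiGGS j) hij
    intro u f hf hfu c hc hcu
    have hmem : ⁅directed c, rootedPow (f (Fin.rev u))⁆ ∈ M := by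
      change graft _ _ ∈ ⁅G, G⁆
      rw [← commutator_directed_conj hcu]
      have ha : rootedA (n + 1) ^ ((u : ℕ) + 1) ∈ G := pow_mem rootedA_mem_multiGGS _
      exact commutator_mem_commutator hc (mul_mem (mul_mem ha hf) (inv_mem ha))
    have hpow : rootedPow (f (Fin.rev u)) ∈ G := pow_mem rootedA_mem_multiGGS _
    exact mem_centralizerMod_comm hc (rootedA_mem_of_rootedPow_mem hfu
      (mem_centralizerMod_comm (x := directed c) (hG := hM) hpow ⟨hc, hmem⟩))
  have hba : ∀ l, directed (e l) ∈ centralizerMod G M hM (rootedA (n + 1)) := fun l =>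
    hle (directed_mem_multiGGS l)
  refine commutator_closure_le hM ?_
  rintro _ (rfl | ⟨k, rfl⟩) _ (rfl | ⟨l, rfl⟩)
  · rw [commutatorElement_self]; exact one_mem _
  · exact (mem_centralizerMod_comm rootedA_mem_multiGGS (hba l)).2
  · exact (hba k).2
  · rw [commutatorElement_eq_one_iff_commute.2 (directed_commute _ _)]; exact one_mem _

end MultiGGS

end TreeAut.AutT

/-- For a multi-GGS-group with `r ≥ 2`, `ψ(G'' ∩ st(1))` contains
`γ₃(G) × ⋯ × γ₃(G)` (`p` factors). -/
theorem psi_second_derived_ge_gamma3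
    (p r : ℕ) (hp : p.Prime) (hpodd : Odd p) (hr : 2 ≤ r)
    (e : Fin r → Fin (p - 1) → ZMod p) (he : LinearIndependent (ZMod p) e) :
    ∀ g : Fin p → AutT p, (∀ x : Fin p, g x ∈ ⁅⁅multiGGS p e, multiGGS p e⁆, multiGGS p e⁆) →
      ∃ f ∈ (⁅⁅multiGGS p e, multiGGS p e⁆, ⁅multiGGS p e, multiGGS p e⁆⁆ ⊓ levelStab p 1 : Subgroup (AutT p)), sections f = g := by
  obtain ⟨n, rfl⟩ := Nat.exists_eq_succ_of_ne_zero hp.ne_zero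
  have : Fact (n + 1).Prime := ⟨hp⟩
  have hn : 0 < n + 1 - 1 := Nat.sub_pos_of_lt hp.one_lt
  have : Nonempty (Fin (n + 1 - 1)) := ⟨⟨0, hn⟩⟩
  set G := multiGGS (n + 1) e with hG
  have hind : LinearIndependent (ZMod (n + 1)) ![e ⟨0, by omega⟩, e ⟨1, by omega⟩] := by
    have h := he.comp ![⟨0, by omega⟩, ⟨1, by omega⟩] (by
      intro x y; fin_cases x <;> fin_cases y <;> simp)
    rwa [show e ∘ ![⟨0, by omega⟩, ⟨1, by omega⟩] = ![e ⟨0, by omega⟩, e ⟨1, by omega⟩] from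
      funext fun x => by fin_cases x <;> rfl] at h
  have hsec : G ≤ sectionSubgroup ⁅G, G⁆ (Fin.last n) := by
    obtain ⟨u, v, huv⟩ | ⟨u, v, huv⟩ := exists_ne_of_linearIndependent hind <;>
      exact multiGGS_le_sectionSubgroup huv
  have hbranch := commutator_le_comap_graftHom hind hsec
  have hlast : ⁅⁅G, G⁆, G⁆ ≤ ⁅⁅G, G⁆, ⁅G, G⁆⁆.comap (graftHom (Fin.last n)) := by
    refine commutator_le.2 fun x hx y hy => ?_
    obtain ⟨h, hh, hr, rfl⟩ := mem_sectionSubgroup.1 (hsec hy)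
    change graft _ _ ∈ ⁅⁅G, G⁆, ⁅G, G⁆⁆
    rw [← graft_commutator hr]
    exact commutator_mem_commutator (hbranch hx) hh
  intro g hg
  refine exists_sections_eq_of_graft_mem fun x => ?_
  have ht : rootedA (n + 1) ^ ((x : ℕ) + 1) ∈ G := pow_mem rootedA_mem_multiGGS _
  have hconj := map_conj_commutator_eq (map_conj_commutator_eq (conj_smul_eq_self_of_mem ht))
  rw [← hconj]
  refine ⟨graft (Fin.last n) (g x), hlast (hg x), ?_⟩
  change rootedA (n + 1) ^ ((x : ℕ) + 1) * _ * (rootedA (n + 1) ^ ((x : ℕ) + 1))⁻¹ = _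
  rw [rootedA_pow, rooted_conj_graft, finRotate_pow_last]
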